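/- The integral I₁(k) = ∫_0^1 log(1-s)/(s-k) ds satisfies I₁(k) = (1/2) log²(k-1) + π²/6 + o(1) as k → 1 with k ∉ [0,1], where log is the principal branch. -/

import Mathlib

open Complex Filter intervalIntegral

open scoped Topology Interval

/-- The Stieltjes-type integral `∫₀¹ log t / (t + z) dt`. -/
noncomputable def logStieltjes (z : ℂ) : ℂ :=
  ∫ t in (0 : ℝ)..1, (Real.log t : ℂ) / ((t : ℂ) + z)

theorem isPreconnected_slitPlane : IsPreconnected slitPlane :=
  (starConvex_one_slitPlane.isPathConnected one_mem_slitPlane).isConnected.isPreconnected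

theorem one_add_mem_slitPlane {z : ℂ} (hz : z ∈ slitPlane) : 1 + z ∈ slitPlane := by
  rw [mem_slitPlane_iff] at *
  rcases hz with h | h
  · left; simp; linarith
  · right; simpa using h

theorem inv_mem_slitPlane {z : ℂ} (hz : z ∈ slitPlane) : z⁻¹ ∈ slitPlane := by
  have h0 : 0 < normSq z := normSq_pos.2 (slitPlane_ne_zero hz)
  rw [mem_slitPlane_iff] at *
  rcases hz with h | h
  · left; rw [inv_re]; positivity
  · right; rw [inv_im]; exact div_ne_zero (neg_ne_zero.2 h) h0.ne'

theorem ofReal_add_ne_zero {z : ℂ} (hz : z ∈ slitPlane) {t : ℝ} (ht : 0 ≤ t) :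
    (t : ℂ) + z ≠ 0 := by
  intro h
  have hz' : z = -(t : ℂ) := by linear_combination h
  rw [hz', neg_ofReal_mem_slitPlane] at hz
  linarith

theorem log_one_add_inv {z : ℂ} (hz : z ∈ slitPlane) :
    log (1 + z⁻¹) = log (1 + z) - log z := by
  have key : ∀ w ∈ slitPlane, HasDerivAt (fun w : ℂ => log (1 + w⁻¹) + log w - log (1 + w)) 0 w := by
    intro w hw
    have hw0 := slitPlane_ne_zero hw
    have h1 := slitPlane_ne_zero (one_add_mem_slitPlane hw)
    have h2 := slitPlane_ne_zero (one_add_mem_slitPlane (inv_mem_slitPlane hw))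
    have h := ((((hasDerivAt_inv hw0).const_add 1).clog
      (one_add_mem_slitPlane (inv_mem_slitPlane hw))).add (hasDerivAt_log hw)).sub
      (((hasDerivAt_id w).const_add 1).clog (one_add_mem_slitPlane hw))
    convert! h using 1
    have h3 : 1 + w⁻¹ = (1 + w) / w := by field_simp; ring
    simp only [id]
    rw [h3]
    field_simp
    ring
  have := isOpen_slitPlane.is_const_of_deriv_eq_zero isPreconnected_slitPlane
    (fun w hw => (key w hw).differentiableAt.differentiableWithinAt)
    (fun w hw => (key w hw).deriv) hz one_mem_slitPlane
  simp at this
  linear_combination this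

theorem intervalIntegrable_ofReal_log (a b : ℝ) :
    IntervalIntegrable (fun t : ℝ => (Real.log t : ℂ)) MeasureTheory.volume a b :=
  ⟨(intervalIntegrable_log' (a := a) (b := b)).1.ofReal,
    (intervalIntegrable_log' (a := a) (b := b)).2.ofReal⟩

theorem continuousOn_inv_ofReal_add {z : ℂ} (hz : z ∈ slitPlane) :
    ContinuousOn (fun t : ℝ => ((t : ℂ) + z)⁻¹) [[(0 : ℝ), 1]] := by
  apply ContinuousOn.inv₀ (by fun_prop)
  intro t ht
  rw [Set.uIcc_of_le zero_le_one] at ht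
  exact ofReal_add_ne_zero hz ht.1

theorem integral_inv_ofReal_add {z : ℂ} (hz : z ∈ slitPlane) :
    ∫ t in (0 : ℝ)..1, ((t : ℂ) + z)⁻¹ = log (1 + z⁻¹) := by
  rw [log_eq_integral (one_add_mem_slitPlane (inv_mem_slitPlane hz)), ← integral_const_mul]
  have hz0 := slitPlane_ne_zero hz
  apply integral_congr
  intro t _
  simp only [real_smul]
  rw [← mul_inv]
  congr 1
  field_simp
  ring

theorem integral_log_div_sq {z : ℂ} (hz : z ∈ slitPlane) :
    ∫ t in (0 : ℝ)..1, (Real.log t : ℂ) * (((t : ℂ) + z)⁻¹) ^ 2 = - (z⁻¹ * log (1 + z⁻¹)) := by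
  have hz0 := slitPlane_ne_zero hz
  have hc := continuousOn_inv_ofReal_add hz
  have i1 : IntervalIntegrable (fun t : ℝ => (Real.log t : ℂ) * (((t : ℂ) + z)⁻¹) ^ 2)
      MeasureTheory.volume 0 1 := (intervalIntegrable_ofReal_log 0 1).mul_continuousOn (hc.pow 2)
  have i2 : IntervalIntegrable (fun t : ℝ => z⁻¹ * ((t : ℂ) + z)⁻¹)
      MeasureTheory.volume 0 1 := hc.intervalIntegrable.const_mul _
  have h := integral_eq_sub_of_hasDerivAt_of_le (a := 0) (b := 1)
    (f := fun t : ℝ => ((t * Real.log t : ℝ) : ℂ) * (z⁻¹ * ((t : ℂ) + z)⁻¹)) zero_le_one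
    (f' := fun t : ℝ => (Real.log t : ℂ) * (((t : ℂ) + z)⁻¹) ^ 2 + z⁻¹ * ((t : ℂ) + z)⁻¹)
    ((continuous_ofReal.comp Real.continuous_mul_log).continuousOn.mul
      (continuousOn_const.mul (by rwa [Set.uIcc_of_le zero_le_one] at hc)))
    (by
      intro t ht
      have hne := ofReal_add_ne_zero hz ht.1.le
      have d1 := (Real.hasDerivAt_mul_log ht.1.ne').ofReal_comp
      have d2 : HasDerivAt (fun t : ℝ => (t : ℂ) + z) 1 t :=
        ((hasDerivAt_id t).ofReal_comp).add_const z
      have d := d1.mul ((d2.inv hne).const_mul z⁻¹)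
      convert! d using 1
      simp only [Pi.inv_apply]
      push_cast
      field_simp
      ring)
    (i1.add i2)
  rw [integral_add i1 i2, integral_const_mul, integral_inv_ofReal_add hz] at h
  simp only [Real.log_one, mul_zero, ofReal_zero, zero_mul, sub_zero] at h
  linear_combination h

theorem hasDerivAt_logStieltjes {z : ℂ} (hz : z ∈ slitPlane) :
    HasDerivAt logStieltjes (z⁻¹ * log (1 + z⁻¹)) z := by
  obtain ⟨m, hm, hmin⟩ : ∃ m : ℝ, 0 < m ∧ ∀ t ∈ Set.Icc (0 : ℝ) 1, m ≤ ‖(t : ℂ) + z‖ := by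
    obtain ⟨t₀, ht₀, h⟩ := isCompact_Icc.exists_isMinOn (Set.nonempty_Icc.2 (zero_le_one (α := ℝ)))
      (f := fun t : ℝ => ‖(t : ℂ) + z‖) (by fun_prop)
    exact ⟨_, norm_pos_iff.2 (ofReal_add_ne_zero hz ht₀.1), fun t ht => h ht⟩
  have hlow : ∀ t ∈ Ι (0 : ℝ) 1, ∀ w ∈ Metric.ball z (m / 2), m / 2 ≤ ‖(t : ℂ) + w‖ := by
    intro t ht w hw
    rw [Set.uIoc_of_le zero_le_one] at ht
    have h1 := hmin t ⟨ht.1.le, ht.2⟩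
    rw [mem_ball_iff_norm'] at hw
    have h2 := norm_add_le ((t : ℂ) + w) (z - w)
    rw [show (t : ℂ) + w + (z - w) = t + z by ring] at h2
    linarith
  have hmeas : ∀ w : ℂ, Measurable (fun t : ℝ => (Real.log t : ℂ) / ((t : ℂ) + w)) := by
    intro w; fun_prop
  have h := hasDerivAt_integral_of_dominated_loc_of_deriv_le (μ := MeasureTheory.volume)
    (a := (0 : ℝ)) (b := 1) (x₀ := z) (s := Metric.ball z (m / 2))
    (F := fun w t => (Real.log t : ℂ) / ((t : ℂ) + w))
    (F' := fun w t => -((Real.log t : ℂ) * (((t : ℂ) + w)⁻¹) ^ 2))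
    (bound := fun t => |Real.log t| * ((m / 2)⁻¹) ^ 2)
    (Metric.ball_mem_nhds z (half_pos hm))
    (Eventually.of_forall fun w => (hmeas w).aestronglyMeasurable)
    (by
      simp only [div_eq_mul_inv]
      exact (intervalIntegrable_ofReal_log 0 1).mul_continuousOn (continuousOn_inv_ofReal_add hz))
    (by
      apply Measurable.aestronglyMeasurable
      fun_prop)
    (by
      refine Eventually.of_forall fun t ht w hw => ?_
      have := hlow t ht w hw
      rw [norm_neg, norm_mul, norm_pow, norm_inv, norm_real, Real.norm_eq_abs]
      gcongr)
    ((intervalIntegrable_log'.abs).mul_const _)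
    (by
      refine Eventually.of_forall fun t ht w hw => ?_
      have hne : (t : ℂ) + w ≠ 0 := norm_pos_iff.1 ((half_pos hm).trans_le (hlow t ht w hw))
      have d := (((hasDerivAt_id w).const_add (t : ℂ)).inv hne).const_mul (Real.log t : ℂ)
      convert! d using 1
      simp only [id]
      field_simp)
  have h2 := h.2
  rw [integral_neg, integral_log_div_sq hz, neg_neg] at h2
  exact h2

theorem hasSum_alternating_inv_sq :
    HasSum (fun n : ℕ => (-1 : ℝ) ^ n / ((n : ℝ) + 1) ^ 2) (Real.pi ^ 2 / 12) := by
  have hz := hasSum_zeta_two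
  have he : HasSum (fun n : ℕ => (1 : ℝ) / ((2 * n : ℕ) : ℝ) ^ 2) (Real.pi ^ 2 / 24) := by
    convert! hz.mul_left (1 / 4) using 1
    · ext n; push_cast; ring
    · ring
  have ho : HasSum (fun n : ℕ => (1 : ℝ) / ((2 * n + 1 : ℕ) : ℝ) ^ 2) (Real.pi ^ 2 / 8) := by
    have hs : Summable (fun n : ℕ => (1 : ℝ) / ((2 * n + 1 : ℕ) : ℝ) ^ 2) :=
      hz.summable.comp_injective (i := fun n : ℕ => 2 * n + 1) (fun a b h => by simpa using h)
    have := (HasSum.even_add_odd (f := fun n : ℕ => (1 : ℝ) / (n : ℝ) ^ 2) he hs.hasSum).unique hz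
    convert! hs.hasSum using 1
    linarith
  have h : HasSum (fun n : ℕ => -(-1 : ℝ) ^ n / (n : ℝ) ^ 2) (Real.pi ^ 2 / 12) := by
    convert! HasSum.even_add_odd (f := fun n : ℕ => -(-1 : ℝ) ^ n / (n : ℝ) ^ 2)
      (m := -(Real.pi ^ 2 / 24)) (m' := Real.pi ^ 2 / 8) ?_ ?_ using 1
    · ring
    · convert! he.neg using 2 with n
      simp [neg_div]
    · convert! ho using 2 with n
      simp [pow_succ]
  rw [← hasSum_nat_add_iff' 1] at h
  convert! h using 1
  · ext n; push_cast; ring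
  · simp

theorem integral_pow_mul_log (n : ℕ) :
    ∫ t in (0 : ℝ)..1, t ^ n * Real.log t = -(1 / ((n : ℝ) + 1) ^ 2) := by
  have hn : (n : ℝ) + 1 ≠ 0 := by positivity
  have h := integral_eq_sub_of_hasDerivAt_of_le (a := 0) (b := 1)
    (f := fun t : ℝ => t ^ n * (t * Real.log t) / (n + 1) - t ^ (n + 1) / (n + 1) ^ 2) zero_le_one
    (f' := fun t : ℝ => t ^ n * Real.log t)
    (((((continuous_pow n).mul Real.continuous_mul_log).div_const _).sub
      ((continuous_pow (n + 1)).div_const _)).continuousOn)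
    (by
      intro t ht
      have ht0 := ht.1.ne'
      have d := ((((hasDerivAt_pow (n + 1) t).mul (Real.hasDerivAt_log ht0)).div_const
        ((n : ℝ) + 1))).sub ((hasDerivAt_pow (n + 1) t).div_const (((n : ℝ) + 1) ^ 2))
      convert! d using 1
      · ext s; simp [pow_succ, mul_assoc]
      · push_cast
        field_simp
        ring)
    (intervalIntegrable_log'.continuousOn_mul (continuous_pow n).continuousOn)
  rw [h]
  simp

theorem integral_log_div_one_add :
    ∫ t in (0 : ℝ)..1, Real.log t / (t + 1) = -(Real.pi ^ 2 / 12) := by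
  have hint : ∀ n : ℕ, MeasureTheory.IntegrableOn
      (fun t : ℝ => (-1) ^ n * (t ^ n * Real.log t)) (Set.Ioo 0 1) := by
    intro n
    have : IntervalIntegrable (fun t : ℝ => (-1) ^ n * (t ^ n * Real.log t))
        MeasureTheory.volume 0 1 :=
      (intervalIntegrable_log'.continuousOn_mul (continuous_pow n).continuousOn).const_mul _
    rwa [intervalIntegrable_iff_integrableOn_Ioo_of_le zero_le_one] at this
  have hval : ∀ n : ℕ, ∫ t in Set.Ioo (0 : ℝ) 1, t ^ n * Real.log t = -(1 / ((n : ℝ) + 1) ^ 2) := by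
    intro n
    rw [← integral_pow_mul_log, integral_of_le zero_le_one, MeasureTheory.integral_Ioc_eq_integral_Ioo]
  have hnorm : ∀ n : ℕ, ∫ t in Set.Ioo (0 : ℝ) 1, ‖(-1) ^ n * (t ^ n * Real.log t)‖ =
      1 / ((n : ℝ) + 1) ^ 2 := by
    intro n
    rw [← neg_neg (1 / _), ← hval, ← MeasureTheory.integral_neg]
    refine MeasureTheory.setIntegral_congr_fun measurableSet_Ioo fun t ht => ?_
    have hl := Real.log_nonpos ht.1.le ht.2.le
    simp [abs_of_nonneg ht.1.le, abs_of_nonpos hl]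
  have h := MeasureTheory.hasSum_integral_of_summable_integral_norm hint (by
    simp only [hnorm]
    have := (summable_nat_add_iff 1).2 hasSum_zeta_two.summable
    simpa using this)
  simp only [MeasureTheory.integral_const_mul, hval] at h
  have h' : HasSum (fun n : ℕ => (-1 : ℝ) ^ n * -(1 / ((n : ℝ) + 1) ^ 2)) (-(Real.pi ^ 2 / 12)) := by
    convert! hasSum_alternating_inv_sq.neg using 2 with n
    ring
  rw [← h.unique h', integral_of_le zero_le_one, MeasureTheory.integral_Ioc_eq_integral_Ioo]
  refine MeasureTheory.setIntegral_congr_fun measurableSet_Ioo fun t ht => ?_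
  have hg := (hasSum_geometric_of_norm_lt_one (ξ := -t)
    (by rw [norm_neg, Real.norm_eq_abs, abs_of_pos ht.1]; exact ht.2)).mul_right (Real.log t)
  have hg' : HasSum (fun n : ℕ => (-1) ^ n * (t ^ n * Real.log t)) (Real.log t / (t + 1)) := by
    convert! hg using 1
    · ext n; rw [neg_pow]; ring
    · rw [sub_neg_eq_add, add_comm 1 t]; ring
  exact hg'.tsum_eq.symm

theorem logStieltjes_one : logStieltjes 1 = -((Real.pi : ℂ) ^ 2 / 12) := by
  have h := congrArg (fun x : ℝ => (x : ℂ)) integral_log_div_one_add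
  simp only [← integral_ofReal] at h
  push_cast at h
  exact h

/-- The inversion formula for the dilogarithm, in terms of `logStieltjes`. -/
theorem logStieltjes_add_logStieltjes_inv {z : ℂ} (hz : z ∈ slitPlane) :
    logStieltjes z + logStieltjes z⁻¹ = -(1 / 2 * log z ^ 2 + (Real.pi : ℂ) ^ 2 / 6) := by
  have key : ∀ w ∈ slitPlane, HasDerivAt
      (fun w : ℂ => logStieltjes w + logStieltjes w⁻¹ + 1 / 2 * log w ^ 2) 0 w := by
    intro w hw
    have hw0 := slitPlane_ne_zero hw
    have h1 := (hasDerivAt_logStieltjes (inv_mem_slitPlane hw)).comp w (hasDerivAt_inv hw0)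
    have h := ((hasDerivAt_logStieltjes hw).add h1).add
      (((hasDerivAt_log hw).pow 2).const_mul (1 / 2))
    convert! h using 1
    rw [log_one_add_inv hw, inv_inv]
    field_simp
    ring
  have := isOpen_slitPlane.is_const_of_deriv_eq_zero isPreconnected_slitPlane
    (fun w hw => (key w hw).differentiableAt.differentiableWithinAt)
    (fun w hw => (key w hw).deriv) hz one_mem_slitPlane
  simp only [inv_one, logStieltjes_one, log_one] at this
  linear_combination this

theorem norm_logStieltjes_le {w : ℂ} (hw : 1 < ‖w‖) : ‖logStieltjes w‖ ≤ (‖w‖ - 1)⁻¹ := by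
  have h : ‖logStieltjes w‖ ≤ ∫ t in (0 : ℝ)..1, -Real.log t * (‖w‖ - 1)⁻¹ := by
    refine norm_integral_le_of_norm_le zero_le_one (Eventually.of_forall fun t ht => ?_)
      (intervalIntegrable_log'.neg.mul_const _)
    have hlow : ‖w‖ - 1 ≤ ‖(t : ℂ) + w‖ := by
      have h2 := norm_sub_le ((t : ℂ) + w) t
      rw [add_sub_cancel_left, norm_real, Real.norm_eq_abs, abs_of_pos ht.1] at h2
      linarith [ht.2]
    have hl := Real.log_nonpos ht.1.le ht.2
    rw [norm_div, norm_real, Real.norm_eq_abs, abs_of_nonpos hl, div_eq_mul_inv]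
    have : 0 < ‖w‖ - 1 := by linarith
    gcongr
    linarith
  rw [integral_mul_const, integral_neg, integral_log_from_zero] at h
  simpa using h

theorem tendsto_logStieltjes_cobounded :
    Tendsto logStieltjes (Bornology.cobounded ℂ) (𝓝 0) := by
  have hn := tendsto_norm_cobounded_atTop (E := ℂ)
  refine squeeze_zero_norm' ?_
    (tendsto_inv_atTop_zero.comp (tendsto_atTop_add_const_right _ (-1) hn))
  filter_upwards [hn.eventually_gt_atTop 1] with w hw
  exact norm_logStieltjes_le hw

theorem integral_log_one_sub_div (k : ℂ) :
    ∫ s in (0 : ℝ)..1, (Real.log (1 - s) : ℂ) / ((s : ℂ) - k) = -logStieltjes (k - 1) := by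
  have h := integral_comp_sub_left (a := 0) (b := 1)
    (fun t : ℝ => -((Real.log t : ℂ) / ((t : ℂ) + (k - 1)))) 1
  rw [sub_self, sub_zero, integral_neg, integral_neg, neg_inj] at h
  rw [logStieltjes, ← h, ← integral_neg]
  refine integral_congr fun s _ => ?_
  rw [← div_neg]
  congr 1
  push_cast
  ring

theorem sub_one_mem_slitPlane {k : ℂ} (hk : k ∉ (fun s : ℝ => (s : ℂ)) '' Set.Icc 0 1)
    (hk1 : ‖k - 1‖ < 1) : k - 1 ∈ slitPlane := by
  by_contra h
  rw [mem_slitPlane_iff] at h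
  push Not at h
  obtain ⟨hre, him⟩ := h
  have habs := abs_le.1 ((abs_re_le_norm (k - 1)).trans hk1.le)
  simp only [sub_re, one_re, sub_im, one_im, sub_zero] at hre him habs
  exact hk ⟨k.re, ⟨by linarith [habs.1], by linarith⟩, Complex.ext (by simp) (by simp [him])⟩

open Complex Filter intervalIntegral

/-- `I₁(k) = ∫_0^1 log(1-s)/(s-k) ds = (1/2)log²(k-1) + π²/6 + o(1)` as
`k → 1`, `k ∉ [0,1]`. -/
theorem I1_asymptotics :
    Tendsto
      (fun k : ℂ =>
        (∫ s in (0 : ℝ)..1, (Real.log (1 - s) : ℂ) / ((s : ℂ) - k)) -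
          ((1 / 2) * (Complex.log (k - 1)) ^ 2 + (Real.pi : ℂ) ^ 2 / 6))
      (nhdsWithin 1 {k : ℂ | k ∉ (fun s : ℝ => (s : ℂ)) '' Set.Icc 0 1})
      (nhds 0) := by
  set S := {k : ℂ | k ∉ (fun s : ℝ => (s : ℂ)) '' Set.Icc 0 1}
  have hmem : ∀ᶠ k in 𝓝[S] 1, k - 1 ∈ slitPlane := by
    filter_upwards [self_mem_nhdsWithin,
      mem_nhdsWithin_of_mem_nhds (Metric.ball_mem_nhds (1 : ℂ) one_pos)] with k hk hk1
    exact sub_one_mem_slitPlane hk (mem_ball_iff_norm.1 hk1)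
  have hsub : Tendsto (fun k : ℂ => k - 1) (𝓝[S] 1) (𝓝[≠] 0) := by
    refine tendsto_nhdsWithin_iff.2 ⟨?_, hmem.mono fun k hk => slitPlane_ne_zero hk⟩
    have : Tendsto (fun k : ℂ => k - 1) (𝓝 1) (𝓝 (1 - 1)) :=
      (continuous_id.sub continuous_const).tendsto 1
    rw [sub_self] at this
    exact this.mono_left nhdsWithin_le_nhds
  refine ((tendsto_logStieltjes_cobounded.comp tendsto_inv₀_nhdsNE_zero).comp hsub).congr' ?_
  filter_upwards [hmem] with k hk
  simp only [Function.comp_apply]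
  rw [integral_log_one_sub_div]
  linear_combination logStieltjes_add_logStieltjes_inv hk
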